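/- arXiv:0705.4089 — 2 statements merged into one kernel-verified Lean document; each statement's English description precedes it below -/
import Mathlib

section
/- Fannes' inequality (as used in the converse): For any two density operators ρ and ω on a d-dimensional Hilbert space, |H(ρ) − H(ω)| ≤ 1/e + (log d) ‖ρ − ω‖₁. -/
noncomputable section
namespace LPD

open Matrix Kronecker BigOperators Filter Finset
open scoped ComplexOrder

/-- The positive semidefinite square root of a positive semidefinite matrix
(Mathlib's former `Matrix.PosSemidef.sqrt`, with its old definition). -/
def _root_.Matrix.PosSemidef.sqrt {n 𝕜 : Type*} [Fintype n] [RCLike 𝕜] [DecidableEq n]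
    {A : Matrix n n 𝕜} (hA : A.PosSemidef) : Matrix n n 𝕜 :=
  hA.1.eigenvectorUnitary.1 * diagonal ((↑) ∘ Real.sqrt ∘ hA.1.eigenvalues) *
    (star hA.1.eigenvectorUnitary : Matrix n n 𝕜)

/-- The trace norm `‖ω‖₁ = Tr √(ωᴴ ω)` of a matrix. -/
def traceNorm {ι : Type*} [Fintype ι] [DecidableEq ι] (ω : Matrix ι ι ℂ) : ℝ :=
  ((Matrix.posSemidef_conjTranspose_mul_self ω).sqrt).trace.re

/-- A density operator: positive semidefinite with trace one. -/
def IsDensity {ι : Type*} [Fintype ι] (ρ : Matrix ι ι ℂ) : Prop :=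
  ρ.PosSemidef ∧ ρ.trace = 1

/-- The von Neumann entropy `H(ρ) = -Tr(ρ log ρ)`, expressed via eigenvalues
(with the convention `0 log 0 = 0`, and junk value `0` on non-Hermitian input). -/
def entropy {ι : Type*} [Fintype ι] [DecidableEq ι] (ρ : Matrix ι ι ℂ) : ℝ :=
  letI := Classical.dec ρ.IsHermitian
  if h : ρ.IsHermitian then -∑ i, h.eigenvalues i * Real.log (h.eigenvalues i) else 0

/-- Partial trace over the first (left) tensor factor. -/
def ptraceLeft {α β : Type*} [Fintype α] (ρ : Matrix (α × β) (α × β) ℂ) : Matrix β β ℂ :=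
  fun b b' => ∑ a, ρ (a, b) (a, b')

/-- Partial trace over the second (right) tensor factor. -/
def ptraceRight {α β : Type*} [Fintype β] (ρ : Matrix (α × β) (α × β) ℂ) : Matrix α α ℂ :=
  fun a a' => ∑ b, ρ (a, b) (a', b)

/-- Quantum mutual information `I(A;B) = H(A) + H(B) - H(AB)` of a bipartite state. -/
def mutualInfo {α β : Type*} [Fintype α] [DecidableEq α] [Fintype β] [DecidableEq β]
    (ρ : Matrix (α × β) (α × β) ℂ) : ℝ :=
  entropy (ptraceRight ρ) + entropy (ptraceLeft ρ) - entropy ρ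

/-- Conditional entropy `H(B|A) = H(AB) - H(A)` (second system conditioned on the first). -/
def condEntropySnd {α β : Type*} [Fintype α] [DecidableEq α] [Fintype β] [DecidableEq β]
    (ρ : Matrix (α × β) (α × β) ℂ) : ℝ :=
  entropy ρ - entropy (ptraceRight ρ)

/-- Conditional entropy `H(A|B) = H(AB) - H(B)` (first system conditioned on the second). -/
def condEntropyFst {α β : Type*} [Fintype α] [DecidableEq α] [Fintype β] [DecidableEq β]
    (ρ : Matrix (α × β) (α × β) ℂ) : ℝ :=
  entropy ρ - entropy (ptraceLeft ρ)

/-- `n`-fold tensor power of a matrix. -/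
def tpow {ι : Type*} (ρ : Matrix ι ι ℂ) (n : ℕ) : Matrix (Fin n → ι) (Fin n → ι) ℂ :=
  fun x y => ∏ k, ρ (x k) (y k)

/-- `n`-fold tensor power of a bipartite state, with the `A` and `B` factors collected. -/
def tpowAB {α β : Type*} (ρ : Matrix (α × β) (α × β) ℂ) (n : ℕ) :
    Matrix ((Fin n → α) × (Fin n → β)) ((Fin n → α) × (Fin n → β)) ℂ :=
  Matrix.reindex (Equiv.arrowProdEquivProdArrow (Fin n) (fun _ => α) (fun _ => β))
    (Equiv.arrowProdEquivProdArrow (Fin n) (fun _ => α) (fun _ => β)) (tpow ρ n)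

/-- A POVM on the system `ι` with outcome set `κ`. -/
structure POVM (ι κ : Type*) [Fintype ι] [DecidableEq ι] [Fintype κ] where
  elem : κ → Matrix ι ι ℂ
  pos : ∀ y, (elem y).PosSemidef
  sum_eq : ∑ y, elem y = 1

/-- Apply a POVM to the first factor of a bipartite state, recording the outcome in a
classical register: `ρ^{AΓ} ↦ Σ_y |y⟩⟨y| ⊗ Tr_A((Λ_y ⊗ 1)ρ)`. -/
def measureLeft {ι κ γ : Type*} [Fintype ι] [DecidableEq ι] [Fintype κ] [DecidableEq κ]
    (Λ : POVM ι κ) (ρ : Matrix (ι × γ) (ι × γ) ℂ) : Matrix (κ × γ) (κ × γ) ℂ :=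
  fun p q => if p.1 = q.1 then ∑ a, ∑ a', (Λ.elem p.1) a a' * ρ (a', p.2) (a, q.2) else 0

/-- The canonical purification of a density operator `ρ` on `ι`, a pure state on `ι × ι`
(junk value `0` for non-positive-semidefinite input). -/
def canonicalPurification {ι : Type*} [Fintype ι] [DecidableEq ι] (ρ : Matrix ι ι ℂ) :
    Matrix (ι × ι) (ι × ι) ℂ :=
  letI := Classical.dec ρ.PosSemidef
  if h : ρ.PosSemidef then
    vecMulVec (fun p => h.sqrt p.1 p.2) (star fun p => h.sqrt p.1 p.2)
  else 0

/-- The purity `κ(ρ) = log d - H(ρ)`. -/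
def kappa {ι : Type*} [Fintype ι] [DecidableEq ι] (ρ : Matrix ι ι ℂ) : ℝ :=
  Real.log (Fintype.card ι) - entropy ρ

/-- The pure state `|0⟩⟨0|` on a `d`-dimensional system. -/
def pureZero (d : ℕ) : Matrix (Fin d) (Fin d) ℂ :=
  fun i j => if i.val = 0 ∧ j.val = 0 then 1 else 0

/-! ### Index bookkeeping equivalences -/

/-- `(a × b) × c ≃ (a × c) × b`. -/
def swapE (a b c : Type*) : (a × b) × c ≃ (a × c) × b where
  toFun x := ((x.1.1, x.2), x.1.2)
  invFun x := ((x.1.1, x.2), x.1.2)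
  left_inv _ := rfl
  right_inv _ := rfl

/-- Pull the `Y` register to the front: `((a × y) × g) × b ≃ y × ((a × g) × b)`. -/
def pullY (a y g b : Type*) : ((a × y) × g) × b ≃ y × ((a × g) × b) where
  toFun x := (x.1.1.2, ((x.1.1.1, x.1.2), x.2))
  invFun x := (((x.2.1.1, x.1), x.2.1.2), x.2.2)
  left_inv _ := rfl
  right_inv _ := rfl

/-- Rearrange for Bob's unitary: `((a × y) × g) × b ≃ (b × y) × (a × g)`. -/
def pullBY (a y g b : Type*) : ((a × y) × g) × b ≃ (b × y) × (a × g) where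
  toFun x := ((x.2, x.1.1.2), (x.1.1.1, x.1.2))
  invFun x := (((x.2.1, x.1.2), x.2.2), x.1.1)
  left_inv _ := rfl
  right_inv _ := rfl

/-- Collect `Y` and `B` together: `((a × y) × g) × b ≃ (y × b) × (a × g)`. -/
def pullYB (a y g b : Type*) : ((a × y) × g) × b ≃ (y × b) × (a × g) where
  toFun x := ((x.1.1.2, x.2), (x.1.1.1, x.1.2))
  invFun x := (((x.2.1, x.1.1), x.2.2), x.1.2)
  left_inv _ := rfl
  right_inv _ := rfl

/-- Sort output registers: `(bp × bg) × (ap × ag) ≃ (ap × bp) × (ag × bg)`. -/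
def sortOut (bp bg ap ag : Type*) : (bp × bg) × (ap × ag) ≃ (ap × bp) × (ag × bg) where
  toFun x := ((x.2.1, x.1.1), (x.2.2, x.1.2))
  invFun x := ((x.1.2, x.2.2), (x.1.1, x.2.1))
  left_inv _ := rfl
  right_inv _ := rfl

/-- `y × (x × w) ≃ (y × w) × x`. -/
def exYW (y x w : Type*) : y × (x × w) ≃ (y × w) × x where
  toFun a := ((a.1, a.2.2), a.2.1)
  invFun a := (a.1.1, (a.2, a.1.2))
  left_inv _ := rfl
  right_inv _ := rfl

/-- `y × (x × w) ≃ (y × x) × w`. -/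
def exYX (y x w : Type*) : y × (x × w) ≃ (y × x) × w where
  toFun a := ((a.1, a.2.1), a.2.2)
  invFun a := (a.1.1, (a.1.2, a.2))
  left_inv _ := rfl
  right_inv _ := rfl

/-- `y × (x × (b × e)) ≃ (y × b) × (x × e)`. -/
def exYB (y x b e : Type*) : y × (x × (b × e)) ≃ (y × b) × (x × e) where
  toFun a := ((a.1, a.2.2.1), (a.2.1, a.2.2.2))
  invFun a := (a.1.1, (a.2.1, (a.1.2, a.2.2)))
  left_inv _ := rfl
  right_inv _ := rfl

/-! ### The state `σ^{YBE}` obtained by measuring Alice's share of a purification -/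

/-- The canonical purification of a bipartite state `ρ^{AB}`, with indices arranged as
`A × (B × E)` where `E = A × B`. -/
def purifyAssoc {α β : Type*} [Fintype α] [DecidableEq α] [Fintype β] [DecidableEq β]
    (ρ : Matrix (α × β) (α × β) ℂ) :
    Matrix (α × (β × (α × β))) (α × (β × (α × β))) ℂ :=
  Matrix.reindex (Equiv.prodAssoc α β (α × β)) (Equiv.prodAssoc α β (α × β))
    (canonicalPurification ρ)

/-- `σ^{YBE} = (Λ ⊗ 1^{BE})(Ψ^{ABE})` for the canonical purification `Ψ` of `ρ^{AB}`. -/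
def sigmaOf {α β κ : Type*} [Fintype α] [DecidableEq α] [Fintype β] [DecidableEq β]
    [Fintype κ] [DecidableEq κ] (ρ : Matrix (α × β) (α × β) ℂ) (Λ : POVM α κ) :
    Matrix (κ × (β × (α × β))) (κ × (β × (α × β))) ℂ :=
  measureLeft Λ (purifyAssoc ρ)

/-- `I(Y;B)` evaluated on a state of the form `σ^{Y(BE)}`: trace out `E`, then take the
mutual information. -/
def IYB {κ β ε : Type*} [Fintype κ] [DecidableEq κ] [Fintype β] [DecidableEq β] [Fintype ε]
    (σ : Matrix (κ × (β × ε)) (κ × (β × ε)) ℂ) : ℝ :=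
  mutualInfo (ptraceRight (Matrix.reindex (Equiv.prodAssoc κ β ε).symm
    (Equiv.prodAssoc κ β ε).symm σ))

/-- `I(Y;BE)` evaluated on a state of the form `σ^{Y(BE)}`. -/
def IYBE {κ β ε : Type*} [Fintype κ] [DecidableEq κ] [Fintype β] [DecidableEq β] [Fintype ε]
    [DecidableEq ε] (σ : Matrix (κ × (β × ε)) (κ × (β × ε)) ℂ) : ℝ :=
  mutualInfo σ

/-- `P^{(1)}_→(ρ^{AB}, R) = max_Λ { I(Y;B)_σ : I(Y;BE)_σ ≤ R }`, the maximum over all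
POVMs on Alice's system. -/
def P1 {α β : Type*} [Fintype α] [DecidableEq α] [Fintype β] [DecidableEq β]
    (ρ : Matrix (α × β) (α × β) ℂ) (R : ℝ) : ℝ :=
  sSup { v : ℝ | ∃ (m : ℕ) (Λ : POVM α (Fin m)),
    IYBE (sigmaOf ρ Λ) ≤ R ∧ v = IYB (sigmaOf ρ Λ) }

/-! ### Local purity distillation protocols -/

/-- An `(n, ·, ·, ·)` local purity distillation protocol: Alice's unitary
`U_A : H_{A^n} ⊗ H_C → H_{A_p} ⊗ H_Y ⊗ H_{A_g}`, a dephasing channel on `Y`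
(applied below), and Bob's unitary `U_B : H_{B^n} ⊗ H_Y → H_{B_p} ⊗ H_{B_g}`. -/
structure Protocol (α β : Type*) [Fintype α] [DecidableEq α] [Fintype β] [DecidableEq β]
    (n : ℕ) where
  dC : ℕ
  dAp : ℕ
  dY : ℕ
  dAg : ℕ
  dBp : ℕ
  dBg : ℕ
  dC_pos : 0 < dC
  dAp_pos : 0 < dAp
  dY_pos : 0 < dY
  dAg_pos : 0 < dAg
  dBp_pos : 0 < dBp
  dBg_pos : 0 < dBg
  UA : Matrix ((Fin dAp × Fin dY) × Fin dAg) ((Fin n → α) × Fin dC) ℂ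
  UA_unitary : UAᴴ * UA = 1 ∧ UA * UAᴴ = 1
  UB : Matrix (Fin dBp × Fin dBg) ((Fin n → β) × Fin dY) ℂ
  UB_unitary : UBᴴ * UB = 1 ∧ UB * UBᴴ = 1

variable {α β : Type*} [Fintype α] [DecidableEq α] [Fintype β] [DecidableEq β]

/-- The input state `(ρ^{AB})^{⊗n} ⊗ |0⟩⟨0|^C`, arranged as `(A^n × C) × B^n`. -/
def inputState (ρ : Matrix (α × β) (α × β) ℂ) {n : ℕ} (Pr : Protocol α β n) :
    Matrix (((Fin n → α) × Fin Pr.dC) × (Fin n → β))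
      (((Fin n → α) × Fin Pr.dC) × (Fin n → β)) ℂ :=
  Matrix.reindex (swapE (Fin n → α) (Fin n → β) (Fin Pr.dC))
    (swapE (Fin n → α) (Fin n → β) (Fin Pr.dC)) (tpowAB ρ n ⊗ₖ pureZero Pr.dC)

/-- The state `U_A((ρ^{AB})^{⊗n} ⊗ |0⟩⟨0|^C)` (before dephasing), on
`((A_p × Y) × A_g) × B^n`. -/
def stateAfterUA (ρ : Matrix (α × β) (α × β) ℂ) {n : ℕ} (Pr : Protocol α β n) :
    Matrix (((Fin Pr.dAp × Fin Pr.dY) × Fin Pr.dAg) × (Fin n → β))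
      (((Fin Pr.dAp × Fin Pr.dY) × Fin Pr.dAg) × (Fin n → β)) ℂ :=
  (Pr.UA ⊗ₖ (1 : Matrix (Fin n → β) (Fin n → β) ℂ)) * inputState ρ Pr *
    (Pr.UA ⊗ₖ (1 : Matrix (Fin n → β) (Fin n → β) ℂ))ᴴ

/-- Dephase the first tensor factor in a fixed basis. -/
def dephaseFst {κ γ : Type*} [DecidableEq κ] (ρ : Matrix (κ × γ) (κ × γ) ℂ) :
    Matrix (κ × γ) (κ × γ) ℂ :=
  fun p q => if p.1 = q.1 then ρ p q else 0

/-- The state after Alice's unitary and the dephasing channel on `Y`. -/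
def stateAfterDephasing (ρ : Matrix (α × β) (α × β) ℂ) {n : ℕ} (Pr : Protocol α β n) :
    Matrix (((Fin Pr.dAp × Fin Pr.dY) × Fin Pr.dAg) × (Fin n → β))
      (((Fin Pr.dAp × Fin Pr.dY) × Fin Pr.dAg) × (Fin n → β)) ℂ :=
  Matrix.reindex (pullY (Fin Pr.dAp) (Fin Pr.dY) (Fin Pr.dAg) (Fin n → β)).symm
    (pullY (Fin Pr.dAp) (Fin Pr.dY) (Fin Pr.dAg) (Fin n → β)).symm
    (dephaseFst (Matrix.reindex (pullY (Fin Pr.dAp) (Fin Pr.dY) (Fin Pr.dAg) (Fin n → β))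
      (pullY (Fin Pr.dAp) (Fin Pr.dY) (Fin Pr.dAg) (Fin n → β)) (stateAfterUA ρ Pr)))

/-- The final state `Υ`, after Bob's unitary, on `(B_p × B_g) × (A_p × A_g)`. -/
def stateAfterUB (ρ : Matrix (α × β) (α × β) ℂ) {n : ℕ} (Pr : Protocol α β n) :
    Matrix ((Fin Pr.dBp × Fin Pr.dBg) × (Fin Pr.dAp × Fin Pr.dAg))
      ((Fin Pr.dBp × Fin Pr.dBg) × (Fin Pr.dAp × Fin Pr.dAg)) ℂ :=
  (Pr.UB ⊗ₖ (1 : Matrix (Fin Pr.dAp × Fin Pr.dAg) (Fin Pr.dAp × Fin Pr.dAg) ℂ)) *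
    Matrix.reindex (pullBY (Fin Pr.dAp) (Fin Pr.dY) (Fin Pr.dAg) (Fin n → β))
      (pullBY (Fin Pr.dAp) (Fin Pr.dY) (Fin Pr.dAg) (Fin n → β)) (stateAfterDephasing ρ Pr) *
    (Pr.UB ⊗ₖ (1 : Matrix (Fin Pr.dAp × Fin Pr.dAg) (Fin Pr.dAp × Fin Pr.dAg) ℂ))ᴴ

/-- The reduced output state `Υ^{A_p B_p}`. -/
def outputReduced (ρ : Matrix (α × β) (α × β) ℂ) {n : ℕ} (Pr : Protocol α β n) :
    Matrix (Fin Pr.dAp × Fin Pr.dBp) (Fin Pr.dAp × Fin Pr.dBp) ℂ :=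
  ptraceRight (Matrix.reindex
    (sortOut (Fin Pr.dBp) (Fin Pr.dBg) (Fin Pr.dAp) (Fin Pr.dAg))
    (sortOut (Fin Pr.dBp) (Fin Pr.dBg) (Fin Pr.dAp) (Fin Pr.dAg)) (stateAfterUB ρ Pr))

/-- The error of a protocol: trace distance of `Υ^{A_p B_p}` from `|0⟩⟨0| ⊗ |0⟩⟨0|`. -/
def protocolError (ρ : Matrix (α × β) (α × β) ℂ) {n : ℕ} (Pr : Protocol α β n) : ℝ :=
  traceNorm (outputReduced ρ Pr - pureZero Pr.dAp ⊗ₖ pureZero Pr.dBp)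

/-- The classical communication rate `(1/n) log d_Y` of a protocol. -/
def commRate {n : ℕ} (Pr : Protocol α β n) : ℝ := Real.log Pr.dY / n

/-- The purity rate `(1/n)(log d_{A_p}d_{B_p} - log d_C)` of a protocol. -/
def purityRate {n : ℕ} (Pr : Protocol α β n) : ℝ :=
  (Real.log (Pr.dAp * Pr.dBp) - Real.log Pr.dC) / n

/-- Achievability of a rate pair `(P, R)`: for all `ε, δ > 0` and all sufficiently large `n`
there is an `(n, R+δ, P-δ, ε)` protocol. -/
def Achievable (ρ : Matrix (α × β) (α × β) ℂ) (P R : ℝ) : Prop :=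
  ∀ ε > (0 : ℝ), ∀ δ > (0 : ℝ), ∃ N : ℕ, ∀ n ≥ N, ∃ Pr : Protocol α β n,
    commRate Pr ≤ R + δ ∧ P - δ ≤ purityRate Pr ∧ protocolError ρ Pr ≤ ε

/-- The 1-way distillable local purity `κ_→(ρ^{AB}, R)`. -/
def kappaArrow (ρ : Matrix (α × β) (α × β) ℂ) (R : ℝ) : ℝ :=
  sSup { P : ℝ | Achievable ρ P R }

/-- `I(Y;B^n)` on the pre-dephasing state `U_A((ρ^{AB})^{⊗n} ⊗ |0⟩⟨0|^C)`. -/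
def preDephIYB (ρ : Matrix (α × β) (α × β) ℂ) {n : ℕ} (Pr : Protocol α β n) : ℝ :=
  mutualInfo (ptraceRight (Matrix.reindex
    (pullYB (Fin Pr.dAp) (Fin Pr.dY) (Fin Pr.dAg) (Fin n → β))
    (pullYB (Fin Pr.dAp) (Fin Pr.dY) (Fin Pr.dAg) (Fin n → β)) (stateAfterUA ρ Pr)))

/-- The pre-dephasing state together with the purifying environment `E^n`:
`(U_A ⊗ 1^{B^nE^n})((Ψ^{ABE})^{⊗n} ⊗ |0⟩⟨0|^C)`, where `Ψ` is the canonical purification. -/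
def preDephWithEnv (ρ : Matrix (α × β) (α × β) ℂ) {n : ℕ} (Pr : Protocol α β n) :
    Matrix (((Fin Pr.dAp × Fin Pr.dY) × Fin Pr.dAg) × (Fin n → β × (α × β)))
      (((Fin Pr.dAp × Fin Pr.dY) × Fin Pr.dAg) × (Fin n → β × (α × β))) ℂ :=
  (Pr.UA ⊗ₖ (1 : Matrix (Fin n → β × (α × β)) (Fin n → β × (α × β)) ℂ)) *
    Matrix.reindex (swapE (Fin n → α) (Fin n → β × (α × β)) (Fin Pr.dC))
      (swapE (Fin n → α) (Fin n → β × (α × β)) (Fin Pr.dC))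
      (tpowAB (purifyAssoc ρ) n ⊗ₖ pureZero Pr.dC) *
    (Pr.UA ⊗ₖ (1 : Matrix (Fin n → β × (α × β)) (Fin n → β × (α × β)) ℂ))ᴴ

/-- `I(Y;B^nE^n)` on the pre-dephasing state, including the purifying environment. -/
def preDephIYBE (ρ : Matrix (α × β) (α × β) ℂ) {n : ℕ} (Pr : Protocol α β n) : ℝ :=
  mutualInfo (ptraceRight (Matrix.reindex
    (pullYB (Fin Pr.dAp) (Fin Pr.dY) (Fin Pr.dAg) (Fin n → β × (α × β)))
    (pullYB (Fin Pr.dAp) (Fin Pr.dY) (Fin Pr.dAg) (Fin n → β × (α × β)))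
    (preDephWithEnv ρ Pr)))

/-- `H(Y)` on the pre-dephasing state. -/
def preDephHY (ρ : Matrix (α × β) (α × β) ℂ) {n : ℕ} (Pr : Protocol α β n) : ℝ :=
  entropy (ptraceRight (Matrix.reindex
    (pullY (Fin Pr.dAp) (Fin Pr.dY) (Fin Pr.dAg) (Fin n → β))
    (pullY (Fin Pr.dAp) (Fin Pr.dY) (Fin Pr.dAg) (Fin n → β)) (stateAfterUA ρ Pr)))

/-! ### Single-party purity concentration -/

/-- An `(n, ·, ·)` purity concentration protocol: a unitary
`U : H_{A^n} → H_{A_p} ⊗ H_{A_g}`. -/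
structure ConcProtocol (α : Type*) [Fintype α] [DecidableEq α] (n : ℕ) where
  dAp : ℕ
  dAg : ℕ
  dAp_pos : 0 < dAp
  dAg_pos : 0 < dAg
  U : Matrix (Fin dAp × Fin dAg) (Fin n → α) ℂ
  U_unitary : Uᴴ * U = 1 ∧ U * Uᴴ = 1

/-- The reduced state `Υ^{A_p}` of `U ρ^{⊗n} U†`. -/
def concOutput {α : Type*} [Fintype α] [DecidableEq α] (ρ : Matrix α α ℂ) {n : ℕ}
    (Pr : ConcProtocol α n) : Matrix (Fin Pr.dAp) (Fin Pr.dAp) ℂ :=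
  ptraceRight (Pr.U * tpow ρ n * Pr.Uᴴ)

/-- Achievability of a purity-concentration rate `P`. -/
def ConcAchievable {α : Type*} [Fintype α] [DecidableEq α] (ρ : Matrix α α ℂ) (P : ℝ) :
    Prop :=
  ∀ ε > (0 : ℝ), ∀ δ > (0 : ℝ), ∃ N : ℕ, ∀ n ≥ N, ∃ Pr : ConcProtocol α n,
    P - δ ≤ Real.log Pr.dAp / n ∧ traceNorm (concOutput ρ Pr - pureZero Pr.dAp) ≤ ε

/-- The purity `κ(ρ)`: the supremum of all achievable concentration rates. -/
def kappaConc {α : Type*} [Fintype α] [DecidableEq α] (ρ : Matrix α α ℂ) : ℝ :=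
  sSup { P : ℝ | ConcAchievable ρ P }

/-! ### Measurement compression -/

/-- The averaged compressed-measurement map
`σ ↦ (1/|L|) Σ_l Σ_m Tr(Λ̃^{(l)}_m σ) |f(m,l)⟩⟨f(m,l)|`, applied to the first factor. -/
def mcMap {A Ω γ' : Type*} [Fintype A] [DecidableEq A] [Fintype Ω] [DecidableEq Ω]
    (L M : ℕ) (Λt : Fin L → POVM A (Fin M)) (f : Fin M → Fin L → Ω)
    (ρ : Matrix (A × γ') (A × γ') ℂ) : Matrix (Ω × γ') (Ω × γ') ℂ :=
  fun p q => (L : ℂ)⁻¹ * ∑ l, ∑ m, (if f m l = p.1 ∧ f m l = q.1 then 1 else 0) *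
    ∑ a, ∑ a', ((Λt l).elem m) a a' * ρ (a', p.2) (a, q.2)

/-! ### Classical-quantum states and classical channels -/

/-- The classical-quantum state `Σ_x p(x) |x⟩⟨x| ⊗ ρ_x`. -/
def cqState {𝒳 B : Type*} [DecidableEq 𝒳] (p : 𝒳 → ℝ) (ρx : 𝒳 → Matrix B B ℂ) :
    Matrix (𝒳 × B) (𝒳 × B) ℂ :=
  fun P Q => if P.1 = Q.1 then (p P.1 : ℂ) * ρx P.1 P.2 Q.2 else 0

/-- The state on `Y × (X × W)` obtained from a purification vector `ψ` of a cq state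
(with classical system `X` and the rest `W`) by applying a classical channel `q(y|x)`
to the classical system: `Σ_{x,y} q(y|x) |y⟩⟨y| ⊗ |x⟩⟨x|-block of p(x)·(BE state given x)`. -/
def chanState {𝒳 W 𝒴 : Type*} [DecidableEq 𝒳] [DecidableEq 𝒴]
    (ψ : 𝒳 × W → ℂ) (q : 𝒳 → 𝒴 → ℝ) :
    Matrix (𝒴 × (𝒳 × W)) (𝒴 × (𝒳 × W)) ℂ :=
  fun P Q => if P.1 = Q.1 ∧ P.2.1 = Q.2.1
    then (q P.2.1 P.1 : ℂ) * ψ P.2 * star (ψ Q.2) else 0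

/-- The `n`-fold tensor power of a purification vector of a cq state, with the
classical, `B` and `E` registers collected. -/
def vecPowBE {𝒳 B E : Type*} (ψ : 𝒳 × (B × E) → ℂ) (n : ℕ) :
    (Fin n → 𝒳) × ((Fin n → B) × (Fin n → E)) → ℂ :=
  fun xw => ∏ k, ψ (xw.1 k, (xw.2.1 k, xw.2.2 k))

variable {𝒴' 𝒳 B E : Type*} [Fintype 𝒴'] [DecidableEq 𝒴'] [Fintype 𝒳] [DecidableEq 𝒳]
  [Fintype B] [DecidableEq B] [Fintype E] [DecidableEq E]

/-- `I(Y;B)` on a state of the form `τ^{Y(X(BE))}`. -/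
def miYB (τ : Matrix (𝒴' × (𝒳 × (B × E))) (𝒴' × (𝒳 × (B × E))) ℂ) : ℝ :=
  mutualInfo (ptraceRight (Matrix.reindex (exYB 𝒴' 𝒳 B E) (exYB 𝒴' 𝒳 B E) τ))

/-- `I(Y;BE)` on a state of the form `τ^{Y(X(BE))}`. -/
def miYBE (τ : Matrix (𝒴' × (𝒳 × (B × E))) (𝒴' × (𝒳 × (B × E))) ℂ) : ℝ :=
  mutualInfo (ptraceRight (Matrix.reindex (exYW 𝒴' 𝒳 (B × E)) (exYW 𝒴' 𝒳 (B × E)) τ))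

/-- `I(Y;X)` on a state of the form `τ^{Y(X(BE))}`. -/
def miYX (τ : Matrix (𝒴' × (𝒳 × (B × E))) (𝒴' × (𝒳 × (B × E))) ℂ) : ℝ :=
  mutualInfo (ptraceRight (Matrix.reindex (exYX 𝒴' 𝒳 (B × E)) (exYX 𝒴' 𝒳 (B × E)) τ))

/-- A classical channel: entrywise nonnegative with rows summing to one. -/
def IsChannel {X Y : Type*} [Fintype Y] (q : X → Y → ℝ) : Prop :=
  (∀ x y, 0 ≤ q x y) ∧ ∀ x, ∑ y, q x y = 1

/-- `P_n(R) = max_{Y|X^n} { (1/n) I(Y;B^n) : (1/n) I(Y;B^nE^n) ≤ R }` for a cq state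
with purification vector `ψ`. -/
def Pn (ψ : 𝒳 × (B × E) → ℂ) (n : ℕ) (R : ℝ) : ℝ :=
  sSup { v : ℝ | ∃ (m : ℕ) (q : (Fin n → 𝒳) → Fin m → ℝ), IsChannel q ∧
    (1 / n : ℝ) * miYBE (chanState (vecPowBE ψ n) q) ≤ R ∧
    v = (1 / n : ℝ) * miYB (chanState (vecPowBE ψ n) q) }

/-- `D_n(R) = max_{Y|X^n} { (1/n) I(Y;B^n) : (1/n)(I(Y;X^n) - I(Y;B^n)) ≤ R }` for a cq
state with purification vector `ψ`. -/
def Dn (ψ : 𝒳 × (B × E) → ℂ) (n : ℕ) (R : ℝ) : ℝ :=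
  sSup { v : ℝ | ∃ (m : ℕ) (q : (Fin n → 𝒳) → Fin m → ℝ), IsChannel q ∧
    (1 / n : ℝ) * (miYX (chanState (vecPowBE ψ n) q)
      - miYB (chanState (vecPowBE ψ n) q)) ≤ R ∧
    v = (1 / n : ℝ) * miYB (chanState (vecPowBE ψ n) q) }

/-! ### Quantum channels -/

/-- A completely positive trace-preserving map between matrix algebras. -/
structure CPTP (ι κ : Type*) [Fintype ι] [DecidableEq ι] [Fintype κ] [DecidableEq κ] where
  map : Matrix ι ι ℂ →ₗ[ℂ] Matrix κ κ ℂ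
  trace_preserving : ∀ ρ, (map ρ).trace = ρ.trace
  completely_positive : ∀ (n : ℕ) (ρ : Matrix (ι × Fin n) (ι × Fin n) ℂ), ρ.PosSemidef →
    (Matrix.of fun p q : κ × Fin n =>
      map (Matrix.of fun i i' => ρ (i, p.2) (i', q.2)) p.1 q.1).PosSemidef

lemma quad_form {ι : Type*} [Fintype ι] [DecidableEq ι] {A : Matrix ι ι ℂ} (hA : A.IsHermitian)
    (v : EuclideanSpace ℂ ι) :
    (inner ℂ v (toEuclideanLin A v)).re =
      ∑ i, hA.eigenvalues i * ‖inner ℂ (hA.eigenvectorBasis i) v‖ ^ 2 := by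
  rw [← hA.eigenvectorBasis.sum_inner_mul_inner, Complex.re_sum]
  refine Finset.sum_congr rfl fun i _ => ?_
  have h1 : inner ℂ (hA.eigenvectorBasis i) (toEuclideanLin A v)
      = hA.eigenvalues i * inner ℂ (hA.eigenvectorBasis i) v := by
    rw [← (isSymmetric_toEuclideanLin_iff.mpr hA) (hA.eigenvectorBasis i) v]
    have : toEuclideanLin A (hA.eigenvectorBasis i)
        = (hA.eigenvalues i : ℂ) • hA.eigenvectorBasis i := by
      apply (WithLp.ofLp_injective 2)
      have := hA.mulVec_eigenvectorBasis i
      simpa [toLpLin_apply] using this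
    rw [this, inner_smul_left]
    simp
  rw [h1, ← inner_conj_symm, mul_left_comm, Complex.re_ofReal_mul, ← Complex.normSq_eq_conj_mul_self,
    Complex.ofReal_re, Complex.normSq_eq_norm_sq]

lemma weyl_mono {ι : Type*} [Fintype ι] [DecidableEq ι] {A M : Matrix ι ι ℂ}
    (hA : A.IsHermitian) (hM : M.IsHermitian) (h : (M - A).PosSemidef) (k : ι) :
    hA.eigenvalues k ≤ hM.eigenvalues k := by
  let e : ι ≃ Fin (Fintype.card ι) := (Fintype.equivOfCardEq (Fintype.card_fin _)).symm
  have mA : ∀ i j, e i ≤ e j → hA.eigenvalues j ≤ hA.eigenvalues i := fun i j hij =>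
    hA.eigenvalues₀_antitone hij
  have mM : ∀ i j, e i ≤ e j → hM.eigenvalues j ≤ hM.eigenvalues i := fun i j hij =>
    hM.eigenvalues₀_antitone hij
  let f : EuclideanSpace ℂ ι →ₗ[ℂ] ({i // i ≠ k} → ℂ) :=
    LinearMap.pi fun i => (innerₛₗ ℂ (if e k < e i then hA.eigenvectorBasis i
      else hM.eigenvectorBasis i))
  have hk : LinearMap.ker f ≠ ⊥ := by
    apply LinearMap.ker_ne_bot_of_finrank_lt
    have : 0 < Fintype.card ι := Fintype.card_pos_iff.mpr ⟨k⟩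
    simp [Fintype.card_subtype_compl]
    omega
  obtain ⟨v, hv, hv0⟩ := (Submodule.ne_bot_iff _).1 hk
  have hv' : ∀ i, i ≠ k → inner ℂ (if e k < e i then hA.eigenvectorBasis i
      else hM.eigenvectorBasis i) v = 0 := fun i hi => congrFun (LinearMap.mem_ker.1 hv) ⟨i, hi⟩
  have hn : 0 < ‖v‖ ^ 2 := by have := norm_pos_iff.2 hv0; positivity
  have hq : (inner ℂ v (toEuclideanLin A v)).re ≤ (inner ℂ v (toEuclideanLin M v)).re := by
    have h2 := h.2
    have h3 := h.dotProduct_mulVec_nonneg v.ofLp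
    have h4 : star v.ofLp ⬝ᵥ (M - A) *ᵥ v.ofLp
        = inner ℂ v (toEuclideanLin M v) - inner ℂ v (toEuclideanLin A v) := by
      rw [← inner_sub_right, ← LinearMap.sub_apply, ← map_sub, EuclideanSpace.inner_eq_star_dotProduct,
        dotProduct_comm]
      rfl
    rw [h4] at h3
    have := (Complex.le_def.1 h3).1
    simpa using this
  have h1 : hA.eigenvalues k * ‖v‖ ^ 2 ≤ (inner ℂ v (toEuclideanLin A v)).re := by
    rw [quad_form hA, ← hA.eigenvectorBasis.sum_sq_norm_inner_right v, Finset.mul_sum]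
    refine Finset.sum_le_sum fun i _ => ?_
    by_cases hi : e k < e i
    · have := hv' i (by rintro rfl; exact lt_irrefl _ hi)
      rw [if_pos hi] at this
      simp [this]
    · exact mul_le_mul_of_nonneg_right (mA _ _ (not_lt.1 hi)) (by positivity)
  have h2 : (inner ℂ v (toEuclideanLin M v)).re ≤ hM.eigenvalues k * ‖v‖ ^ 2 := by
    rw [quad_form hM, ← hM.eigenvectorBasis.sum_sq_norm_inner_right v, Finset.mul_sum]
    refine Finset.sum_le_sum fun i _ => ?_
    by_cases hi : e k ≤ e i
    · exact mul_le_mul_of_nonneg_right (mM _ _ hi) (by positivity)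
    · have := hv' i (by rintro rfl; exact hi le_rfl)
      rw [if_neg (fun h => hi h.le)] at this
      simp [this]
  exact le_of_mul_le_mul_right (h1.trans (hq.trans h2)) hn

lemma eta_sub {a b : ℝ} (ha : 0 ≤ a) (hb : 0 ≤ b) :
    Real.negMulLog (a + b) ≤ Real.negMulLog a + Real.negMulLog b := by
  have key : ∀ x y : ℝ, 0 ≤ x → 0 ≤ y → x * Real.log x ≤ x * Real.log (x + y) := by
    intro x y hx hy
    rcases hx.eq_or_lt with rfl | hx
    · simp
    · exact mul_le_mul_of_nonneg_left (Real.log_le_log hx (by linarith)) hx.le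
  have h1 := key a b ha hb
  have h2 := key b a hb ha
  rw [add_comm b a] at h2
  simp only [Real.negMulLog]
  linarith

lemma eta_low {r n T : ℝ} (hr : 0 ≤ r) (hn : 0 ≤ n) (hnT : n ≤ T) (hT : 0 < T) :
    Real.negMulLog r - (r + n) * Real.log (1 + T) ≤ Real.negMulLog (r + n) := by
  have hcv := Real.concaveOn_negMulLog.2
  have h := @hcv r hr (n / T) (div_nonneg hn hT.le) (1 / (1 + T)) (T / (1 + T))
    (by positivity) (by positivity) (by field_simp)
  have h0 := Real.negMulLog_nonneg (x := n / T) (div_nonneg hn hT.le) ((div_le_one hT).2 hnT)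
  have e : (1 / (1 + T)) • r + (T / (1 + T)) • (n / T) = (1 / (1 + T)) * (r + n) := by
    simp only [smul_eq_mul]; field_simp
  rw [e, Real.negMulLog_mul] at h
  have h3 : Real.negMulLog (1 / (1 + T)) = Real.log (1 + T) / (1 + T) := by
    simp [Real.negMulLog]; field_simp
  rw [h3] at h
  simp only [smul_eq_mul] at h
  have h4 : 0 ≤ T / (1 + T) * Real.negMulLog (n / T) := by positivity
  have h5 : 1 / (1 + T) * Real.negMulLog r ≤
    (r + n) * (Real.log (1 + T) / (1 + T)) + 1 / (1 + T) * Real.negMulLog (r + n) := by linarith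
  have hp : 0 < 1 + T := by linarith
  have h6 := mul_le_mul_of_nonneg_left h5 hp.le
  field_simp at h6
  linarith

lemma eta_up {p c : ℝ} (hp : 0 ≤ p) (hc : 0 < c) :
    Real.negMulLog p ≤ - p * Real.log c + (c - p) := by
  rcases hp.eq_or_lt with rfl | hp
  · simp [hc.le]
  · have := Real.log_le_sub_one_of_pos (x := c / p) (by positivity)
    rw [Real.log_div hc.ne' hp.ne'] at this
    have := mul_le_mul_of_nonneg_left this hp.le
    have e : p * (c / p - 1) = c - p := by field_simp
    rw [e] at this
    simp only [Real.negMulLog]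
    linarith

lemma eta_e {T : ℝ} (hT : 0 ≤ T) : Real.negMulLog T ≤ 1 / Real.exp 1 := by
  have := eta_up hT (c := 1 / Real.exp 1) (by positivity)
  simp at this
  simp
  linarith

lemma classical {ι : Type*} [Fintype ι] [DecidableEq ι] (r s : ι → ℝ)
    (hr : ∀ i, 0 ≤ r i) (hs : ∀ i, 0 ≤ s i) (r1 : ∑ i, r i = 1) (s1 : ∑ i, s i = 1) :
    ∑ i, Real.negMulLog (r i) - ∑ i, Real.negMulLog (s i) ≤
      1 / Real.exp 1 + Real.log (Fintype.card ι) * ∑ i, |r i - s i| := by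
  have hl : 0 ≤ Real.log (Fintype.card ι) := Real.log_natCast_nonneg _
  set p : ι → ℝ := fun i => max (r i - s i) 0 with hpd
  set n : ι → ℝ := fun i => max (s i - r i) 0 with hnd
  have hp : ∀ i, 0 ≤ p i := fun i => le_max_right _ _
  have hn : ∀ i, 0 ≤ n i := fun i => le_max_right _ _
  have hpn : ∀ i, r i + n i = s i + p i := by
    intro i; simp only [hpd, hnd]; grind
  have habs : ∀ i, |r i - s i| = p i + n i := by
    intro i; simp only [hpd, hnd]; grind
  set T := ∑ i, p i with hTd
  have hnT : ∑ i, n i = T := by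
    have : ∑ i, (r i + n i) = ∑ i, (s i + p i) := Finset.sum_congr rfl fun i _ => hpn i
    rw [Finset.sum_add_distrib, Finset.sum_add_distrib] at this
    linarith
  have habsT : ∑ i, |r i - s i| = 2 * T := by
    rw [Finset.sum_congr rfl fun i _ => habs i, Finset.sum_add_distrib, hnT]; ring
  have hT0 : 0 ≤ T := Finset.sum_nonneg fun i _ => hp i
  have hT1 : T ≤ 1 := by
    rw [← r1]
    refine Finset.sum_le_sum fun i _ => max_le ?_ (hr i)
    linarith [hs i]
  rw [habsT]
  rcases hT0.eq_or_lt with h0 | hT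
  · have hp0 := (Finset.sum_eq_zero_iff_of_nonneg fun i _ => hp i).1 h0.symm
    have hn0 := (Finset.sum_eq_zero_iff_of_nonneg fun i _ => hn i).1 (hnT.trans h0.symm)
    have : r = s := by
      funext i
      have := hpn i
      rw [hp0 i (mem_univ _), hn0 i (mem_univ _)] at this
      simpa using this
    rw [this, ← h0]
    simp [Real.exp_nonneg]
  -- a zero of p
  obtain ⟨j, -, hj⟩ : ∃ j ∈ (univ : Finset ι), 0 < n j := by
    by_contra! hcon
    have := Finset.sum_nonpos hcon
    linarith
  have hpj : p j = 0 := by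
    have h1 : 0 < s j - r j := by
      rcases lt_max_iff.1 hj with h | h
      · exact h
      · exact absurd h (lt_irrefl _)
    exact max_eq_right (by linarith)
  obtain ⟨j', -, hj'⟩ : ∃ j ∈ (univ : Finset ι), 0 < p j := by
    by_contra! hcon
    have := Finset.sum_nonpos hcon
    linarith
  have hne : j' ≠ j := by rintro rfl; linarith
  have hcard : 2 ≤ Fintype.card ι := by
    have : Nontrivial ι := ⟨⟨j', j, hne⟩⟩
    exact Fintype.one_lt_card
  set d : ℝ := (Fintype.card ι : ℝ) with hd
  have hd2 : 2 ≤ d := by rw [hd]; exact_mod_cast hcard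
  have A1 : ∑ i, Real.negMulLog (s i + p i) ≤
      ∑ i, Real.negMulLog (s i) + ∑ i, Real.negMulLog (p i) := by
    rw [← Finset.sum_add_distrib]
    exact Finset.sum_le_sum fun i _ => eta_sub (hs i) (hp i)
  have A2 : ∑ i, Real.negMulLog (r i) - (1 + T) * Real.log (1 + T) ≤
      ∑ i, Real.negMulLog (s i + p i) := by
    have : ∑ i, (Real.negMulLog (r i) - (r i + n i) * Real.log (1 + T)) ≤
        ∑ i, Real.negMulLog (s i + p i) := by
      refine Finset.sum_le_sum fun i _ => ?_
      rw [← hpn i]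
      exact eta_low (hr i) (hn i)
        (hnT ▸ Finset.single_le_sum (f := n) (fun i _ => hn i) (mem_univ i)) hT
    rwa [Finset.sum_sub_distrib, ← Finset.sum_mul, Finset.sum_add_distrib, r1, hnT] at this
  have A3 : ∑ i, Real.negMulLog (p i) ≤ T * Real.log (d - 1) + Real.negMulLog T := by
    have hc : 0 < T / (d - 1) := div_pos hT (by linarith)
    rw [← Finset.sum_erase (s := univ) (a := j) (by simp [hpj])]
    have hTe : ∑ i ∈ univ.erase j, p i = T := Finset.sum_erase _ hpj
    have : ∑ i ∈ univ.erase j, Real.negMulLog (p i) ≤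
        ∑ i ∈ univ.erase j, (- p i * Real.log (T / (d - 1)) + (T / (d - 1) - p i)) :=
      Finset.sum_le_sum fun i _ => eta_up (hp i) hc
    rw [Finset.sum_add_distrib, ← Finset.sum_mul, Finset.sum_neg_distrib, Finset.sum_sub_distrib,
      hTe, Finset.sum_const, Finset.card_erase_of_mem (mem_univ _), Finset.card_univ, nsmul_eq_mul,
      Nat.cast_sub (by omega), Nat.cast_one, ← hd, mul_div_cancel₀ _ (by linarith : d - 1 ≠ 0),
      Real.log_div hT.ne' (by linarith)] at this
    have e : Real.negMulLog T = - T * Real.log T := rfl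
    rw [e]
    linarith
  have A4 := eta_e hT0
  have A5 : (1 + T) * Real.log (1 + T) ≤ T * (2 * Real.log 2) := by
    have hcv := Real.convexOn_mul_log.2
    have h := @hcv 1 (by simp) 2 (by simp) (1 - T) T (by linarith) hT0 (by ring)
    simp only [smul_eq_mul, Real.log_one] at h
    have e : (1 - T) * 1 + T * 2 = 1 + T := by ring
    rw [e] at h
    linarith
  have A6 : Real.log (d - 1) + 2 * Real.log 2 ≤ 2 * Real.log d := by
    have h1 : 2 * Real.log 2 = Real.log 4 := by
      rw [show (4 : ℝ) = 2 ^ 2 by norm_num, Real.log_pow]; norm_num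
    have h2 : 2 * Real.log d = Real.log (d ^ 2) := by rw [Real.log_pow]; norm_num
    rw [h1, h2, ← Real.log_mul (by linarith) (by norm_num)]
    exact Real.log_le_log (by linarith) (by nlinarith [sq_nonneg (d - 2)])
  have A7 := mul_le_mul_of_nonneg_left A6 hT0
  linarith

lemma trace_conj {ι : Type*} [Fintype ι] [DecidableEq ι] (U : Matrix.unitaryGroup ι ℂ)
    (f : ι → ℂ) : (U.1 * diagonal f * star U.1).trace = ∑ i, f i := by
  rw [Matrix.trace_mul_comm, ← Matrix.mul_assoc, Unitary.coe_star_mul_self, Matrix.one_mul,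
    Matrix.trace_diagonal]

lemma herm_decomp {ι : Type*} [Fintype ι] [DecidableEq ι] {D : Matrix ι ι ℂ}
    (hD : D.IsHermitian) : D = hD.eigenvectorUnitary.1 *
      diagonal (fun i => (hD.eigenvalues i : ℂ)) * star hD.eigenvectorUnitary.1 := by
  have := hD.spectral_theorem
  rw [Unitary.conjStarAlgAut_apply] at this
  exact this

lemma traceNorm_herm {ι : Type*} [Fintype ι] [DecidableEq ι] {D : Matrix ι ι ℂ}
    (hD : D.IsHermitian) : traceNorm D = ∑ i, |hD.eigenvalues i| := by
  have hP := Matrix.posSemidef_conjTranspose_mul_self D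
  have h1 : traceNorm D = ∑ i, Real.sqrt (hP.1.eigenvalues i) := by
    unfold traceNorm Matrix.PosSemidef.sqrt
    rw [trace_conj, Complex.re_sum]
    simp
  have hsq : Dᴴ * D = hD.eigenvectorUnitary.1 *
      diagonal (fun i => ((hD.eigenvalues i ^ 2 : ℝ) : ℂ)) * star hD.eigenvectorUnitary.1 := by
    rw [hD.eq]
    conv_lhs => rw [herm_decomp hD]
    have hu := Unitary.coe_star_mul_self hD.eigenvectorUnitary
    calc _ = hD.eigenvectorUnitary.1 * diagonal (fun i => (hD.eigenvalues i : ℂ)) *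
          (star hD.eigenvectorUnitary.1 * hD.eigenvectorUnitary.1) *
          diagonal (fun i => (hD.eigenvalues i : ℂ)) * star hD.eigenvectorUnitary.1 := by
            simp only [Matrix.mul_assoc]
      _ = _ := by
        rw [hu, Matrix.mul_one, Matrix.mul_assoc _ (diagonal _) (diagonal _),
          Matrix.diagonal_mul_diagonal]
        simp only [sq, Complex.ofReal_mul]
  have hroots : (Dᴴ * D).charpoly.roots =
      Multiset.map (fun i => ((hD.eigenvalues i ^ 2 : ℝ) : ℂ)) Finset.univ.val := by
    rw [hsq, Matrix.charpoly_mul_comm, ← Matrix.mul_assoc, Unitary.coe_star_mul_self,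
      Matrix.one_mul, Matrix.charpoly_diagonal, Polynomial.roots_prod]
    · simp only [Polynomial.roots_X_sub_C, Multiset.bind_singleton]
    · exact Finset.prod_ne_zero_iff.2 fun i _ => Polynomial.X_sub_C_ne_zero _
  rw [hP.1.roots_charpoly_eq_eigenvalues] at hroots
  have h2 := congrArg (fun m => (m.map (fun z : ℂ => Real.sqrt z.re)).sum) hroots
  simp only [Multiset.map_map, Function.comp_def] at h2
  rw [h1]
  calc _ = _ := h2
    _ = _ := Finset.sum_congr rfl fun i _ => by
      rw [Complex.ofReal_re, Real.sqrt_sq_eq_abs]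

lemma abs_exists {ι : Type*} [Fintype ι] [DecidableEq ι] {D : Matrix ι ι ℂ}
    (hD : D.IsHermitian) : ∃ Q : Matrix ι ι ℂ, (Q - D).PosSemidef ∧ (Q + D).PosSemidef ∧
      Q.IsHermitian ∧ Q.trace = (traceNorm D : ℂ) := by
  have key : ∀ f : ι → ℝ, (∀ i, 0 ≤ f i) → (hD.eigenvectorUnitary.1 *
      diagonal (fun i => (f i : ℂ)) * star hD.eigenvectorUnitary.1).PosSemidef := by
    intro f hf
    apply Matrix.PosSemidef.mul_mul_conjTranspose_same
    apply Matrix.PosSemidef.diagonal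
    intro i
    exact Complex.zero_le_real.2 (hf i)
  refine ⟨hD.eigenvectorUnitary.1 *
      diagonal (fun i => ((|hD.eigenvalues i| : ℝ) : ℂ)) * star hD.eigenvectorUnitary.1,
      ?_, ?_, (key _ fun i => abs_nonneg _).1, ?_⟩
  · have := key (fun i => |hD.eigenvalues i| - hD.eigenvalues i)
      fun i => sub_nonneg.2 (le_abs_self _)
    convert this using 1
    conv_lhs => rw [sub_eq_add_neg]; arg 2; rw [herm_decomp hD]
    rw [← sub_eq_add_neg, ← Matrix.sub_mul, ← Matrix.mul_sub, Matrix.diagonal_sub]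
    simp
  · have := key (fun i => |hD.eigenvalues i| + hD.eigenvalues i)
      fun i => by linarith [neg_abs_le (hD.eigenvalues i)]
    convert this using 1
    conv_lhs => arg 2; rw [herm_decomp hD]
    rw [← Matrix.add_mul, ← Matrix.mul_add, Matrix.diagonal_add]
    simp
  · rw [trace_conj, traceNorm_herm hD]
    push_cast
    rfl

lemma sum_eig {ι : Type*} [Fintype ι] [DecidableEq ι] {A : Matrix ι ι ℂ}
    (hA : A.IsHermitian) : ∑ i, hA.eigenvalues i = A.trace.re := by
  rw [hA.trace_eq_sum_eigenvalues, Complex.re_sum]; simp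

lemma entropy_eq {ι : Type*} [Fintype ι] [DecidableEq ι] {A : Matrix ι ι ℂ}
    (hA : A.IsHermitian) : entropy A = ∑ i, Real.negMulLog (hA.eigenvalues i) := by
  unfold entropy
  rw [dif_pos hA, ← Finset.sum_neg_distrib]
  simp [Real.negMulLog]

lemma mirsky {ι : Type*} [Fintype ι] [DecidableEq ι] {A B : Matrix ι ι ℂ}
    (hA : A.IsHermitian) (hB : B.IsHermitian) :
    ∑ i, |hA.eigenvalues i - hB.eigenvalues i| ≤ traceNorm (A - B) := by
  obtain ⟨Q, h1, h2, hQ, h3⟩ := abs_exists (hA.sub hB)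
  have hhalf : (0 : ℂ) ≤ 1 / 2 := by
    rw [Complex.le_def]; norm_num
  set M : Matrix ι ι ℂ := (1 / 2 : ℂ) • (A + B + Q) with hM
  have hMA : (M - A).PosSemidef := by
    have := h1.smul hhalf
    convert this using 1
    rw [hM]; module
  have hMB : (M - B).PosSemidef := by
    have := h2.smul hhalf
    convert this using 1
    rw [hM]; module
  have hMh : M.IsHermitian := by
    have := hMA.1.add hA
    simpa using this
  have ht : M.trace.re = (A.trace.re + B.trace.re + traceNorm (A - B)) / 2 := by
    rw [hM, Matrix.trace_smul, Matrix.trace_add, Matrix.trace_add, h3, smul_eq_mul]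
    have : (1 / 2 : ℂ) = ((1 / 2 : ℝ) : ℂ) := by norm_num
    rw [this, Complex.re_ofReal_mul]
    simp
    ring
  calc ∑ i, |hA.eigenvalues i - hB.eigenvalues i|
      ≤ ∑ i, (2 * hMh.eigenvalues i - hA.eigenvalues i - hB.eigenvalues i) := by
        refine Finset.sum_le_sum fun i _ => ?_
        have a := weyl_mono hA hMh hMA i
        have b := weyl_mono hB hMh hMB i
        rw [abs_le]; constructor <;> linarith
    _ = traceNorm (A - B) := by
        rw [Finset.sum_sub_distrib, Finset.sum_sub_distrib, ← Finset.mul_sum, sum_eig, sum_eig,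
          sum_eig, ht]
        ring

/-- **Fannes' inequality** (in the form used in the converse): for density operators on a
`d`-dimensional Hilbert space, `|H(ρ) - H(ω)| ≤ 1/e + (log d) ‖ρ - ω‖₁`. -/
theorem fannes_inequality {ι : Type*} [Fintype ι] [DecidableEq ι]
    (ρ ω : Matrix ι ι ℂ) (hρ : IsDensity ρ) (hω : IsDensity ω) :
    |entropy ρ - entropy ω| ≤
      1 / Real.exp 1 + Real.log (Fintype.card ι) * traceNorm (ρ - ω) := by
  have hl : 0 ≤ Real.log (Fintype.card ι) := Real.log_natCast_nonneg _
  have hm := mul_le_mul_of_nonneg_left (mirsky hρ.1.1 hω.1.1) hl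
  have r1 : ∑ i, hρ.1.1.eigenvalues i = 1 := by rw [sum_eig, hρ.2]; simp
  have s1 : ∑ i, hω.1.1.eigenvalues i = 1 := by rw [sum_eig, hω.2]; simp
  have c1 := classical _ _ hρ.1.eigenvalues_nonneg hω.1.eigenvalues_nonneg r1 s1
  have c2 := classical _ _ hω.1.eigenvalues_nonneg hρ.1.eigenvalues_nonneg s1 r1
  simp only [abs_sub_comm (hω.1.1.eigenvalues _)] at c2
  rw [entropy_eq hρ.1.1, entropy_eq hω.1.1, abs_le]
  constructor <;> linarith

end LPD
end
end

section
/- Subadditivity of von Neumann entropy: For any density operator ρ^{AB} on the tensor product of two finite-dimensional Hilbert spaces, H(A)_ρ + H(B)_ρ ≥ H(AB)_ρ, where H(A)_ρ and H(B)_ρ are the entropies of the reduced states; equivalently, conditioning does not increase entropy: H(B)_ρ ≥ H(AB)_ρ − H(A)_ρ = H(B|A)_ρ. -/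
noncomputable section
namespace LPD

open Matrix Kronecker BigOperators Filter Finset
open scoped ComplexOrder

variable {α β : Type*} [Fintype α] [DecidableEq α] [Fintype β] [DecidableEq β]

variable {𝒴' 𝒳 B E : Type*} [Fintype 𝒴'] [DecidableEq 𝒴'] [Fintype 𝒳] [DecidableEq 𝒳]
  [Fintype B] [DecidableEq B] [Fintype E] [DecidableEq E]

lemma ent_eq {ι : Type*} [Fintype ι] [DecidableEq ι] {ρ : Matrix ι ι ℂ} (h : ρ.IsHermitian) :
    entropy ρ = ∑ i, Real.negMulLog (h.eigenvalues i) := by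
  unfold entropy
  rw [dif_pos h]
  simp [Real.negMulLog]

lemma ptraceRight_conj {α β : Type*} [Fintype α] [DecidableEq α] [Fintype β]
    [DecidableEq β] (ρ : Matrix (α × β) (α × β) ℂ) (C E : Matrix α α ℂ) (D F : Matrix β β ℂ)
    (h : F * D = 1) : ptraceRight ((C ⊗ₖ D) * ρ * (E ⊗ₖ F)) = C * ptraceRight ρ * E := by
  have hF : ∀ b' b, ∑ j, F b' j * D j b = if b' = b then 1 else 0 := by
    intro b' b
    rw [← Matrix.mul_apply, h, Matrix.one_apply]
  ext i i'
  simp only [ptraceRight, Matrix.mul_apply, Matrix.kroneckerMap_apply, Fintype.sum_prod_type,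
    Finset.sum_mul, Finset.mul_sum]
  calc _ = ∑ a', ∑ b', ∑ a, ∑ b, C i a * ρ (a, b) (a', b') * E a' i' * ∑ j, F b' j * D j b := by
        rw [Finset.sum_comm]
        refine Finset.sum_congr rfl fun a' _ => ?_
        rw [Finset.sum_comm]
        refine Finset.sum_congr rfl fun b' _ => ?_
        rw [Finset.sum_comm]
        refine Finset.sum_congr rfl fun a _ => ?_
        rw [Finset.sum_comm]
        refine Finset.sum_congr rfl fun b _ => ?_
        rw [Finset.mul_sum]
        refine Finset.sum_congr rfl fun j _ => ?_
        ring
    _ = _ := by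
        simp only [hF, mul_ite, mul_one, mul_zero, Finset.sum_ite_eq, Finset.mem_univ, if_true]
        refine Finset.sum_congr rfl fun a' _ => ?_
        rw [Finset.sum_comm]

lemma ptraceLeft_conj {α β : Type*} [Fintype α] [DecidableEq α] [Fintype β]
    [DecidableEq β] (ρ : Matrix (α × β) (α × β) ℂ) (C E : Matrix α α ℂ) (D F : Matrix β β ℂ)
    (h : E * C = 1) : ptraceLeft ((C ⊗ₖ D) * ρ * (E ⊗ₖ F)) = D * ptraceLeft ρ * F := by
  have hF : ∀ b' b, ∑ j, E b' j * C j b = if b' = b then 1 else 0 := by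
    intro b' b
    rw [← Matrix.mul_apply, h, Matrix.one_apply]
  ext i i'
  simp only [ptraceLeft, Matrix.mul_apply, Matrix.kroneckerMap_apply, Fintype.sum_prod_type,
    Finset.sum_mul, Finset.mul_sum]
  calc _ = ∑ b', ∑ a', ∑ b, ∑ a, D i b * ρ (a, b) (a', b') * F b' i' * ∑ j, E a' j * C j a := by
        rw [Finset.sum_comm, Finset.sum_comm (s := (Finset.univ : Finset β))]
        refine Finset.sum_congr rfl fun a' _ => ?_
        rw [Finset.sum_comm]
        refine Finset.sum_congr rfl fun b' _ => ?_
        rw [Finset.sum_comm, Finset.sum_comm (s := (Finset.univ : Finset β))]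
        refine Finset.sum_congr rfl fun a _ => ?_
        rw [Finset.sum_comm]
        refine Finset.sum_congr rfl fun b _ => ?_
        rw [Finset.mul_sum]
        refine Finset.sum_congr rfl fun j _ => ?_
        ring
    _ = _ := by
        simp only [hF, mul_ite, mul_one, mul_zero, Finset.sum_ite_eq, Finset.mem_univ, if_true]
        refine Finset.sum_congr rfl fun a' _ => ?_
        rw [Finset.sum_comm]

lemma spec {ι : Type*} [Fintype ι] [DecidableEq ι] {ρ : Matrix ι ι ℂ} (h : ρ.IsHermitian) :
    ∃ U : Matrix ι ι ℂ, Uᴴ * U = 1 ∧ U * Uᴴ = 1 ∧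
      ρ = U * diagonal (fun i => (h.eigenvalues i : ℂ)) * Uᴴ := by
  refine ⟨h.eigenvectorUnitary.1, ?_, ?_, ?_⟩
  · exact Unitary.coe_star_mul_self h.eigenvectorUnitary
  · exact Unitary.coe_mul_star_self h.eigenvectorUnitary
  · conv_lhs => rw [h.spectral_theorem, Unitary.conjStarAlgAut_apply]
    rfl

lemma diag_entry {ι : Type*} [Fintype ι] [DecidableEq ι] (Q : Matrix ι ι ℂ) (l : ι → ℝ) (x : ι) :
    ((Q * diagonal (fun i => (l i : ℂ)) * Qᴴ) x x) = ((∑ k, Complex.normSq (Q x k) * l k : ℝ) : ℂ) := by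
  rw [Matrix.mul_apply]
  push_cast
  refine Finset.sum_congr rfl fun k _ => ?_
  rw [Matrix.mul_diagonal, Matrix.conjTranspose_apply, Complex.normSq_eq_conj_mul_self]
  simp only [RCLike.star_def]
  ring

lemma row_sum {ι : Type*} [Fintype ι] [DecidableEq ι] (Q : Matrix ι ι ℂ) (h : Q * Qᴴ = 1) (x : ι) :
    ∑ k, Complex.normSq (Q x k) = 1 := by
  have := diag_entry Q (fun _ => 1) x
  have h1 : (diagonal (fun _ => ((1:ℝ):ℂ)) : Matrix ι ι ℂ) = 1 := by simp
  rw [h1, mul_one, h, Matrix.one_apply_eq] at this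
  simp only [mul_one] at this
  exact_mod_cast this.symm

lemma col_sum {ι : Type*} [Fintype ι] [DecidableEq ι] (Q : Matrix ι ι ℂ) (h : Qᴴ * Q = 1) (k : ι) :
    ∑ x, Complex.normSq (Q x k) = 1 := by
  have := row_sum Qᴴ (by rw [conjTranspose_conjTranspose]; exact h) k
  simpa [Matrix.conjTranspose_apply, Complex.normSq_conj] using this

lemma diag_nonneg_ent {ι : Type*} [Fintype ι] [DecidableEq ι] {ρ : Matrix ι ι ℂ}
    (hρ : ρ.PosSemidef) (W : Matrix ι ι ℂ) (h1 : Wᴴ * W = 1) (h2 : W * Wᴴ = 1) :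
    entropy ρ ≤ ∑ x, Real.negMulLog ((Wᴴ * ρ * W) x x).re := by
  obtain ⟨X, hX1, hX2, hX⟩ := spec hρ.1
  rw [ent_eq hρ.1]
  have hl : ∀ k, 0 ≤ hρ.1.eigenvalues k := hρ.eigenvalues_nonneg
  generalize hρ.1.eigenvalues = l at *
  have hQ : Wᴴ * ρ * W = (Wᴴ * X) * diagonal (fun i => (l i : ℂ)) * (Wᴴ * X)ᴴ := by
    rw [hX, conjTranspose_mul, conjTranspose_conjTranspose]
    simp only [Matrix.mul_assoc]
  have q1 : (Wᴴ * X) * (Wᴴ * X)ᴴ = 1 := by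
    rw [conjTranspose_mul, conjTranspose_conjTranspose, Matrix.mul_assoc, ← Matrix.mul_assoc X, hX2,
      Matrix.one_mul, h1]
  have q2 : (Wᴴ * X)ᴴ * (Wᴴ * X) = 1 := by
    rw [conjTranspose_mul, conjTranspose_conjTranspose, Matrix.mul_assoc, ← Matrix.mul_assoc W, h2,
      Matrix.one_mul, hX1]
  rw [hQ]
  generalize Wᴴ * X = Q at *
  simp only [diag_entry, Complex.ofReal_re]
  calc ∑ k, Real.negMulLog (l k) = ∑ k, (∑ x, Complex.normSq (Q x k)) * Real.negMulLog (l k) := by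
        simp [col_sum Q q2]
    _ = ∑ x, ∑ k, Complex.normSq (Q x k) * Real.negMulLog (l k) := by
        simp only [Finset.sum_mul]
        exact Finset.sum_comm
    _ ≤ _ := by
        refine Finset.sum_le_sum fun x _ => ?_
        have := Real.concaveOn_negMulLog.le_map_sum (t := Finset.univ)
          (w := fun k => Complex.normSq (Q x k)) (p := l)
          (fun k _ => Complex.normSq_nonneg _) (row_sum Q q1 x) (fun k _ => hl k)
        simpa only [smul_eq_mul] using this

lemma term_ineq (d a b : ℝ) (hd : 0 ≤ d) (ha : d ≤ a) (hb : d ≤ b) :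
    Real.negMulLog d ≤ -(d * Real.log a) - d * Real.log b + a * b - d := by
  rcases hd.eq_or_lt with rfl | hd
  · simp
    positivity
  have ha' : 0 < a := by linarith
  have hb' : 0 < b := by linarith
  have := Real.log_le_sub_one_of_pos (x := a * b / d) (by positivity)
  rw [Real.log_div (by positivity) hd.ne', Real.log_mul ha'.ne' hb'.ne'] at this
  have h2 := mul_le_mul_of_nonneg_left this hd.le
  have h3 : d * (a * b / d - 1) = a * b - d := by field_simp
  rw [h3] at h2
  unfold Real.negMulLog
  linarith

lemma classical_s17 {α β : Type*} [Fintype α] [Fintype β] (d : α × β → ℝ) (a : α → ℝ) (b : β → ℝ)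
    (hd : ∀ x, 0 ≤ d x) (ha : ∀ i, ∑ j, d (i, j) = a i) (hb : ∀ j, ∑ i, d (i, j) = b j)
    (h1 : ∑ x, d x = 1) :
    ∑ x, Real.negMulLog (d x) ≤ ∑ i, Real.negMulLog (a i) + ∑ j, Real.negMulLog (b j) := by
  have hla : ∀ i j, d (i, j) ≤ a i := fun i j => by
    rw [← ha i]
    exact Finset.single_le_sum (f := fun j => d (i, j)) (fun j _ => hd (i, j)) (Finset.mem_univ j)
  have hlb : ∀ i j, d (i, j) ≤ b j := fun i j => by
    rw [← hb j]
    exact Finset.single_le_sum (f := fun i => d (i, j)) (fun i _ => hd (i, j)) (Finset.mem_univ i)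
  have sa : ∑ i, a i = 1 := by
    rw [← h1, Fintype.sum_prod_type]; simp only [ha]
  have sb : ∑ j, b j = 1 := by
    rw [← h1, Fintype.sum_prod_type_right]; simp only [hb]
  have e1 : ∑ x : α × β, d x * Real.log (a x.1) = ∑ i, a i * Real.log (a i) := by
    rw [Fintype.sum_prod_type]; simp only [← Finset.sum_mul, ha]
  have e2 : ∑ x : α × β, d x * Real.log (b x.2) = ∑ j, b j * Real.log (b j) := by
    rw [Fintype.sum_prod_type_right]; simp only [← Finset.sum_mul, hb]
  have e3 : ∑ x : α × β, a x.1 * b x.2 = 1 := by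
    rw [Fintype.sum_prod_type]; simp only [← Finset.mul_sum, sb, mul_one, sa]
  calc _ ≤ ∑ x : α × β, (-(d x * Real.log (a x.1)) - d x * Real.log (b x.2) + a x.1 * b x.2 - d x) :=
        Finset.sum_le_sum fun x _ => term_ineq _ _ _ (hd x) (hla x.1 x.2) (hlb x.1 x.2)
    _ = _ := by
        rw [Finset.sum_sub_distrib, Finset.sum_add_distrib, Finset.sum_sub_distrib,
          Finset.sum_neg_distrib, e1, e2, e3, h1]
        simp [Real.negMulLog]
        ring

lemma subadd_main {α β : Type*} [Fintype α] [DecidableEq α] [Fintype β]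
    [DecidableEq β] (ρ : Matrix (α × β) (α × β) ℂ) (hρ : IsDensity ρ) :
    entropy ρ ≤ entropy (ptraceRight ρ) + entropy (ptraceLeft ρ) := by
  obtain ⟨hp, ht⟩ := hρ
  have hA : (ptraceRight ρ).IsHermitian := by
    ext i j
    simp only [ptraceRight, conjTranspose_apply, star_sum]
    exact Finset.sum_congr rfl fun b _ => hp.1.apply _ _
  have hB : (ptraceLeft ρ).IsHermitian := by
    ext i j
    simp only [ptraceLeft, conjTranspose_apply, star_sum]
    exact Finset.sum_congr rfl fun b _ => hp.1.apply _ _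
  obtain ⟨U, hU1, hU2, hU⟩ := spec hA
  obtain ⟨V, hV1, hV2, hV⟩ := spec hB
  have hW : (U ⊗ₖ V)ᴴ = Uᴴ ⊗ₖ Vᴴ := conjTranspose_kronecker U V
  have w1 : (U ⊗ₖ V)ᴴ * (U ⊗ₖ V) = 1 := by
    rw [hW, ← mul_kronecker_mul, hU1, hV1, one_kronecker_one]
  have w2 : (U ⊗ₖ V) * (U ⊗ₖ V)ᴴ = 1 := by
    rw [hW, ← mul_kronecker_mul, hU2, hV2, one_kronecker_one]
  refine (diag_nonneg_ent hp _ w1 w2).trans ?_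
  rw [ent_eq hA, ent_eq hB]
  refine classical_s17 (fun x => (((U ⊗ₖ V)ᴴ * ρ * (U ⊗ₖ V)) x x).re) _ _ ?_ ?_ ?_ ?_
  · intro x
    have := (hp.conjTranspose_mul_mul_same (U ⊗ₖ V)).diag_nonneg (i := x)
    exact (Complex.le_def.1 this).1
  · intro i
    have := congrFun (congrFun (ptraceRight_conj ρ Uᴴ U Vᴴ V hV2) i) i
    rw [← hW] at this
    have h2 : Uᴴ * ptraceRight ρ * U = diagonal (fun i => (hA.eigenvalues i : ℂ)) := by
      conv_lhs => rw [hU]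
      simp only [Matrix.mul_assoc, hU1, Matrix.mul_one]
      rw [← Matrix.mul_assoc, hU1, Matrix.one_mul]
    rw [h2, diagonal_apply_eq] at this
    rw [← Complex.re_sum]
    exact congrArg Complex.re this
  · intro i
    have := congrFun (congrFun (ptraceLeft_conj ρ Uᴴ U Vᴴ V hU2) i) i
    rw [← hW] at this
    have h2 : Vᴴ * ptraceLeft ρ * V = diagonal (fun i => (hB.eigenvalues i : ℂ)) := by
      conv_lhs => rw [hV]
      simp only [Matrix.mul_assoc, hV1, Matrix.mul_one]
      rw [← Matrix.mul_assoc, hV1, Matrix.one_mul]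
    rw [h2, diagonal_apply_eq] at this
    rw [← Complex.re_sum]
    exact congrArg Complex.re this
  · rw [← Complex.re_sum]
    have : ((U ⊗ₖ V)ᴴ * ρ * (U ⊗ₖ V)).trace = 1 := by
      rw [Matrix.trace_mul_cycle, w2, Matrix.one_mul, ht]
    exact (congrArg Complex.re this).trans Complex.one_re

/-- **Subadditivity of von Neumann entropy.** `H(A) + H(B) ≥ H(AB)`; equivalently,
conditioning does not increase entropy: `H(B) ≥ H(AB) - H(A) = H(B|A)`. -/
theorem entropy_subadditive {α β : Type*} [Fintype α] [DecidableEq α] [Fintype β]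
    [DecidableEq β] (ρ : Matrix (α × β) (α × β) ℂ) (hρ : IsDensity ρ) :
    entropy ρ ≤ entropy (ptraceRight ρ) + entropy (ptraceLeft ρ) ∧
      entropy ρ - entropy (ptraceRight ρ) ≤ entropy (ptraceLeft ρ) := by
  have h := subadd_main ρ hρ
  exact ⟨h, by linarith⟩

end LPD
end
end
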